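/- arXiv:1808.01252 — 3 statements merged into one kernel-verified Lean document; each statement's English description precedes it below -/
import Mathlib

section
/- Fix γ > 0 and l_p > 0. Consider the set of single-vertex area eigenvalues A(j_u, j_d, j) := 4πγ l_p² √(2 j_u(j_u+1) + 2 j_d(j_d+1) − j(j+1)), where j_u, j_d, j range over half-integers (2j_u, 2j_d, 2j ∈ ℕ) with (j_u, j_d) ≠ (0,0) and |j_u − j_d| ≤ j ≤ j_u + j_d. Then the least element of this set of eigenvalues is 2π√3 γ l_p² (the area gap), attained at (j_u, j_d, j) = (1/2, 0, 1/2). -/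
theorem sqrt_three_quarters : Real.sqrt (3 / 4) = Real.sqrt 3 / 2 := by
  rw [Real.sqrt_div (by norm_num), show (4 : ℝ) = 2 ^ 2 by norm_num,
    Real.sqrt_sq (by norm_num)]

/-- Twice-spins `a`, `b`, not both zero, satisfy `3 ≤ (a - b)² + 2(a + b)`. -/
theorem three_le_sub_sq_add_two_mul_add {a b : ℕ} (h : ¬(a = 0 ∧ b = 0)) :
    (3 : ℝ) ≤ ((a : ℝ) - b) ^ 2 + 2 * (a + b) := by
  rcases Nat.lt_or_ge (a + b) 2 with hlt | hge
  · obtain ⟨rfl, rfl⟩ | ⟨rfl, rfl⟩ : (a = 1 ∧ b = 0) ∨ (a = 0 ∧ b = 1) := by omega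
    all_goals norm_num
  · have hge' : (2 : ℝ) ≤ a + b := by exact_mod_cast hge
    nlinarith [sq_nonneg ((a : ℝ) - b)]

/-- The radicand of the area eigenvalue is at least `3 / 4`. -/
theorem three_quarters_le_radicand {a b n : ℕ} (h : ¬(a = 0 ∧ b = 0))
    (hn : (n : ℝ) / 2 ≤ (a : ℝ) / 2 + (b : ℝ) / 2) :
    (3 / 4 : ℝ) ≤ 2 * ((a : ℝ) / 2) * ((a : ℝ) / 2 + 1)
      + 2 * ((b : ℝ) / 2) * ((b : ℝ) / 2 + 1) - ((n : ℝ) / 2) * ((n : ℝ) / 2 + 1) := by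
  have hj : ((n : ℝ) / 2) * ((n : ℝ) / 2 + 1) ≤
      ((a : ℝ) / 2 + (b : ℝ) / 2) * ((a : ℝ) / 2 + (b : ℝ) / 2 + 1) := by
    gcongr
  linarith [three_le_sub_sq_add_two_mul_add h]

/-- The least single-vertex area eigenvalue
`A(j_u, j_d, j) = 4πγ l_p² √(2 j_u(j_u+1) + 2 j_d(j_d+1) − j(j+1))`,
over half-integers `j_u = nu/2`, `j_d = nd/2`, `j = n/2` with
`(j_u, j_d) ≠ (0,0)` and `|j_u − j_d| ≤ j ≤ j_u + j_d`, is the area gap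
`2π√3 γ l_p²`, attained at `(j_u, j_d, j) = (1/2, 0, 1/2)`. -/
theorem area_gap (γ lp : ℝ) (hγ : 0 < γ) (hlp : 0 < lp) :
    IsLeast
      { A : ℝ | ∃ nu nd n : ℕ, ¬(nu = 0 ∧ nd = 0) ∧
          |(nu : ℝ) / 2 - (nd : ℝ) / 2| ≤ (n : ℝ) / 2 ∧
          (n : ℝ) / 2 ≤ (nu : ℝ) / 2 + (nd : ℝ) / 2 ∧
          A = 4 * Real.pi * γ * lp ^ 2 *
            Real.sqrt (2 * ((nu : ℝ) / 2) * ((nu : ℝ) / 2 + 1)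
              + 2 * ((nd : ℝ) / 2) * ((nd : ℝ) / 2 + 1)
              - ((n : ℝ) / 2) * ((n : ℝ) / 2 + 1)) }
      (2 * Real.pi * Real.sqrt 3 * γ * lp ^ 2) ∧
    2 * Real.pi * Real.sqrt 3 * γ * lp ^ 2 =
      4 * Real.pi * γ * lp ^ 2 *
        Real.sqrt (2 * (1 / 2) * (1 / 2 + 1) + 2 * 0 * (0 + 1)
          - (1 / 2) * (1 / 2 + 1)) := by
  have hgap : 2 * Real.pi * Real.sqrt 3 * γ * lp ^ 2 =
      4 * Real.pi * γ * lp ^ 2 * Real.sqrt (3 / 4) := by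
    rw [sqrt_three_quarters]
    ring
  refine ⟨⟨⟨1, 0, 1, by norm_num, by norm_num, by norm_num, ?_⟩, ?_⟩, ?_⟩
  · rw [hgap]
    norm_num
  · rintro A ⟨nu, nd, n, h0, -, hn, rfl⟩
    rw [hgap]
    have := three_quarters_le_radicand h0 hn
    gcongr
  · rw [hgap]
    norm_num
end

section
/- There exists a unique γ₀ > 0 such that Σ_{n=1}^∞ (n+1) e^{−πγ₀ √(n(n+2))} = 1 (i.e., log Z(γ₀) = 0, so the LQG black-hole entropy reproduces the Bekenstein–Hawking value at γ = γ₀). Moreover 1/5 < γ₀ < 1. -/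
/-- The LQG black-hole horizon partition function at the Unruh temperature,
as a function of the Immirzi parameter `γ`:
`Z(γ) = ∑_{n≥1} (n+1) e^{−πγ √(n(n+2))}` (spins `j = n/2`). -/
noncomputable def horizonZ (γ : ℝ) : ℝ :=
  ∑' n : {n : ℕ // 1 ≤ n},
    ((n.val : ℝ) + 1) *
      Real.exp (-(Real.pi * γ) * Real.sqrt ((n.val : ℝ) * ((n.val : ℝ) + 2)))

/-- The summand of `horizonZ`, reindexed by `ℕ` through `n ↦ n + 1`. -/
noncomputable def horizonTerm (γ : ℝ) (n : ℕ) : ℝ :=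
  ((n : ℝ) + 2) * Real.exp (-(Real.pi * γ) * Real.sqrt (((n : ℝ) + 1) * ((n : ℝ) + 3)))

theorem horizonZ_eq_tsum (γ : ℝ) : horizonZ γ = ∑' n : ℕ, horizonTerm γ n := by
  let e : ℕ ≃ {n : ℕ // 1 ≤ n} :=
    { toFun := fun n => ⟨n + 1, by omega⟩
      invFun := fun n => n.val - 1
      left_inv := fun n => by simp
      right_inv := fun n => Subtype.ext (Nat.sub_add_cancel n.2) }
  rw [horizonZ, ← e.tsum_eq]
  refine tsum_congr fun n => ?_
  simp only [e, Equiv.coe_fn_mk, horizonTerm]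
  push_cast
  ring_nf

theorem horizonTerm_pos (γ : ℝ) (n : ℕ) : 0 < horizonTerm γ n := by
  unfold horizonTerm
  positivity

theorem horizonTerm_strictAnti (n : ℕ) : StrictAnti fun γ => horizonTerm γ n := by
  intro a b hab
  have hs : 0 < Real.sqrt (((n : ℝ) + 1) * ((n : ℝ) + 3)) := by positivity
  have := mul_lt_mul_of_pos_right (mul_lt_mul_of_pos_left hab Real.pi_pos) hs
  refine mul_lt_mul_of_pos_left (Real.exp_lt_exp.2 ?_) (by positivity)
  linarith

theorem horizonTerm_le {γ : ℝ} (hγ : 0 < γ) (n : ℕ) :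
    horizonTerm γ n ≤ ((n : ℝ) + 2) * Real.exp (-(Real.pi * γ)) ^ (n + 1) := by
  have hs : (n : ℝ) + 1 ≤ Real.sqrt (((n : ℝ) + 1) * ((n : ℝ) + 3)) :=
    Real.le_sqrt_of_sq_le (by nlinarith [Nat.cast_nonneg (α := ℝ) n])
  have := mul_le_mul_of_nonneg_left hs (mul_pos Real.pi_pos hγ).le
  rw [← Real.exp_nat_mul]
  refine mul_le_mul_of_nonneg_left (Real.exp_le_exp.2 ?_) (by positivity)
  push_cast
  linarith

theorem le_horizonTerm {γ : ℝ} (hγ : 0 < γ) (n : ℕ) :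
    ((n : ℝ) + 2) * Real.exp (-(Real.pi * γ)) ^ (n + 2) ≤ horizonTerm γ n := by
  have hs : Real.sqrt (((n : ℝ) + 1) * ((n : ℝ) + 3)) ≤ (n : ℝ) + 2 :=
    Real.sqrt_le_iff.2 ⟨by positivity, by nlinarith⟩
  have := mul_le_mul_of_nonneg_left hs (mul_pos Real.pi_pos hγ).le
  rw [← Real.exp_nat_mul]
  refine mul_le_mul_of_nonneg_left (Real.exp_le_exp.2 ?_) (by positivity)
  push_cast
  linarith

theorem hasSum_add_two_mul_pow {r : ℝ} (h0 : 0 ≤ r) (h1 : r < 1) :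
    HasSum (fun n : ℕ => ((n : ℝ) + 2) * r ^ (n + 1)) (r * (r / (1 - r) ^ 2 + 2 * (1 - r)⁻¹)) := by
  have hr : ‖r‖ < 1 := by rwa [Real.norm_of_nonneg h0]
  have := ((hasSum_coe_mul_geometric_of_norm_lt_one hr).add
    ((hasSum_geometric_of_lt_one h0 h1).mul_left 2)).mul_left r
  refine this.congr_fun fun n => ?_
  ring

theorem exp_neg_pi_mul_lt_one {γ : ℝ} (hγ : 0 < γ) : Real.exp (-(Real.pi * γ)) < 1 :=
  Real.exp_lt_one_iff.2 (neg_neg_of_pos (mul_pos Real.pi_pos hγ))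

theorem summable_horizonTerm {γ : ℝ} (hγ : 0 < γ) : Summable (horizonTerm γ) :=
  (hasSum_add_two_mul_pow (Real.exp_pos _).le (exp_neg_pi_mul_lt_one hγ)).summable.of_nonneg_of_le
    (fun n => (horizonTerm_pos γ n).le) (horizonTerm_le hγ)

theorem horizonZ_strictAntiOn : StrictAntiOn horizonZ (Set.Ioi 0) := by
  intro a ha b hb hab
  rw [horizonZ_eq_tsum, horizonZ_eq_tsum]
  exact Summable.tsum_lt_tsum (i := 0) (fun n => (horizonTerm_strictAnti n hab).le)
    (horizonTerm_strictAnti 0 hab) (summable_horizonTerm hb) (summable_horizonTerm ha)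

theorem continuousOn_horizonZ_Ici {a : ℝ} (ha : 0 < a) : ContinuousOn horizonZ (Set.Ici a) := by
  rw [funext horizonZ_eq_tsum]
  refine continuousOn_tsum (fun n => ?_) (summable_horizonTerm ha) fun n γ hγ => ?_
  · unfold horizonTerm
    fun_prop
  · rw [Real.norm_of_nonneg (horizonTerm_pos γ n).le]
    exact (horizonTerm_strictAnti n).antitone hγ

theorem one_lt_horizonZ_one_fifth : 1 < horizonZ (1 / 5) := by
  have h0 : (0 : ℝ) < 1 / 5 := by norm_num
  have hx : 1 / 2 ≤ Real.exp (-(Real.pi * (1 / 5))) := by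
    have h2 : (1 / 2 : ℝ) = Real.exp (-Real.log 2) := by
      rw [Real.exp_neg, Real.exp_log two_pos, one_div]
    rw [h2, Real.exp_le_exp]
    linarith [Real.pi_lt_d2, Real.log_two_gt_d9]
  have hterm (n : ℕ) : ((n : ℝ) + 2) * (1 / 2) ^ (n + 2) ≤ horizonTerm (1 / 5) n := by
    refine le_trans ?_ (le_horizonTerm h0 n)
    gcongr
  have hsum := (summable_horizonTerm h0).sum_le_tsum (Finset.range 3)
    fun n _ => (horizonTerm_pos _ n).le
  rw [← horizonZ_eq_tsum] at hsum
  have hfin := Finset.sum_le_sum fun n (_ : n ∈ Finset.range 3) => hterm n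
  norm_num [Finset.sum_range_succ] at hfin hsum
  linarith

theorem horizonZ_one_lt_one : horizonZ 1 < 1 := by
  set r := Real.exp (-(Real.pi * 1)) with hr
  have hr0 : 0 < r := Real.exp_pos _
  have hr4 : r < 1 / 4 := by
    have h4 : (1 / 4 : ℝ) = Real.exp (-(2 * Real.log 2)) := by
      rw [Real.exp_neg, two_mul, Real.exp_add, Real.exp_log two_pos]
      norm_num
    rw [h4, hr, Real.exp_lt_exp]
    linarith [Real.pi_gt_three, Real.log_two_lt_d9]
  have hsum := hasSum_add_two_mul_pow hr0.le (by linarith)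
  have hle := (summable_horizonTerm one_pos).tsum_le_tsum (horizonTerm_le one_pos) hsum.summable
  rw [← horizonZ_eq_tsum, hsum.tsum_eq] at hle
  refine hle.trans_lt ?_
  have hne : 0 < 1 - r := by linarith
  have : r * (r / (1 - r) ^ 2 + 2 * (1 - r)⁻¹) = (r * (2 - r)) / (1 - r) ^ 2 := by
    field_simp
    ring
  rw [this, div_lt_one (by positivity)]
  nlinarith

/-- There exists a unique `γ₀ > 0` with `Z(γ₀) = 1`
(i.e. `log Z(γ₀) = 0`, so the LQG black-hole entropy reproduces the
Bekenstein–Hawking value); moreover `1/5 < γ₀ < 1`. -/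
theorem immirzi_parameter_exists_unique :
    (∃! γ₀ : ℝ, 0 < γ₀ ∧ horizonZ γ₀ = 1) ∧
    (∀ γ₀ : ℝ, 0 < γ₀ → horizonZ γ₀ = 1 → 1 / 5 < γ₀ ∧ γ₀ < 1) := by
  have bounds : ∀ γ : ℝ, 0 < γ → horizonZ γ = 1 → 1 / 5 < γ ∧ γ < 1 := by
    intro γ hγ h
    constructor
    · refine (horizonZ_strictAntiOn.lt_iff_gt hγ (Set.mem_Ioi.2 (by norm_num))).1 ?_
      exact h ▸ one_lt_horizonZ_one_fifth
    · refine (horizonZ_strictAntiOn.lt_iff_gt (Set.mem_Ioi.2 one_pos) hγ).1 ?_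
      exact h ▸ horizonZ_one_lt_one
  refine ⟨?_, bounds⟩
  obtain ⟨γ, hγ, h⟩ := intermediate_value_Icc' (by norm_num : (1 / 5 : ℝ) ≤ 1)
    ((continuousOn_horizonZ_Ici (by norm_num : (0 : ℝ) < 1 / 5)).mono Set.Icc_subset_Ici_self)
    ⟨horizonZ_one_lt_one.le, one_lt_horizonZ_one_fifth.le⟩
  have hpos : 0 < γ := lt_of_lt_of_le (by norm_num) hγ.1
  exact ⟨γ, ⟨hpos, h⟩, fun δ hδ => horizonZ_strictAntiOn.injOn hδ.1 hpos (hδ.2.trans h.symm)⟩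
end

section
/- Frodden–Ghosh–Perez near-horizon energy: let M > 0 and G > 0, and for r > 0 define the redshifted energy E(r) := M √((2GM + r)/r) and the proper distance to the horizon d(r) := √(r(2GM + r)). Then E(r)·d(r) = M(2GM + r) for every r > 0, and hence E(r)·d(r) → 2GM² as r → 0⁺. Equivalently, with horizon area A := 4π(2GM)² and near-horizon acceleration a := 1/d, the limiting energy satisfies E = aA/(8πG). -/
/-- Frodden–Ghosh–Perez near-horizon energy: for `M, G > 0`,
with redshifted energy `E(r) = M √((2GM + r)/r)` and proper distance
`d(r) = √(r(2GM + r))`, one has `E(r)·d(r) = M(2GM + r)` for all `r > 0`,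
hence `E(r)·d(r) → 2GM²` as `r → 0⁺`; equivalently, with horizon area
`A = 4π(2GM)²`, `A/(8πG) = 2GM²` (i.e. `E = aA/(8πG)` with `a = 1/d`). -/
theorem frodden_ghosh_perez_energy (M G : ℝ) (hM : 0 < M) (hG : 0 < G) :
    (∀ r : ℝ, 0 < r →
      (M * Real.sqrt ((2 * G * M + r) / r)) * Real.sqrt (r * (2 * G * M + r))
        = M * (2 * G * M + r)) ∧
    Filter.Tendsto
      (fun r : ℝ =>
        (M * Real.sqrt ((2 * G * M + r) / r)) * Real.sqrt (r * (2 * G * M + r)))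
      (nhdsWithin 0 (Set.Ioi 0)) (nhds (2 * G * M ^ 2)) ∧
    4 * Real.pi * (2 * G * M) ^ 2 / (8 * Real.pi * G) = 2 * G * M ^ 2 := by
  have key : ∀ r : ℝ, 0 < r →
      (M * Real.sqrt ((2 * G * M + r) / r)) * Real.sqrt (r * (2 * G * M + r))
        = M * (2 * G * M + r) := by
    intro r hr
    have hs : 0 < 2 * G * M + r := by positivity
    rw [mul_assoc, ← Real.sqrt_mul (by positivity),
      show (2 * G * M + r) / r * (r * (2 * G * M + r)) = (2 * G * M + r) ^ 2 by
        field_simp,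
      Real.sqrt_sq hs.le]
  refine ⟨key, ?_, ?_⟩
  · have hlim : Filter.Tendsto (fun r : ℝ => M * (2 * G * M + r))
        (nhdsWithin 0 (Set.Ioi 0)) (nhds (2 * G * M ^ 2)) := by
      have hcont : Continuous fun r : ℝ => M * (2 * G * M + r) := by fun_prop
      convert (hcont.tendsto 0).mono_left nhdsWithin_le_nhds using 2
      ring
    exact hlim.congr' (eventually_nhdsWithin_of_forall fun r hr => (key r hr).symm)
  · have hpi := Real.pi_ne_zero
    field_simp
    ring
end
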